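/- Standard form of the edge γ·e₀ in terms of δ_𝔫 and ε_𝔫: Let 𝔫 ∈ A₊ and γ = (a, b; c, d) ∈ GL₂(A) (so that the bottom-row entries c, d are coprime in A). Then there exist γ₀ ∈ Γ₀(𝔫), u ∈ K_∞, z ∈ K_∞^×, and κ ∈ I_∞ such that γ₀·γ = w_𝔫 · (π_∞^{deg 𝔫 + 2·δ_𝔫(c,d) + ε_𝔫(c,d)}, u; 0, 1) · (0, 1; π_∞, 0)^{ε_𝔫(c,d)} · z · κ, where w_𝔫 := (0, −1; 𝔫, 0). -/

import Mathlib

open Polynomial Matrix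

noncomputable section

namespace SturmFF

variable (Fq : Type) [Field Fq] [Fintype Fq]

/-- The local field `K_∞ = 𝔽_q((π_∞))`. -/
abbrev Kinf := LaurentSeries Fq

/-- The uniformizer `π_∞`. -/
def piInf : Kinf Fq := HahnSeries.single 1 1

/-- The element `θ = π_∞⁻¹` of `K_∞`. -/
def thetaK : Kinf Fq := HahnSeries.single (-1) 1

/-- The embedding `A = 𝔽_q[θ] → K_∞` sending `θ` to `π_∞⁻¹`. -/
def polyToK : Polynomial Fq →+* Kinf Fq := (Polynomial.aeval (thetaK Fq)).toRingHom

/-- Membership in the valuation ring `O_∞ = 𝔽_q[[π_∞]]`. -/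
def memO (x : Kinf Fq) : Prop := ∀ n : ℤ, n < 0 → x.coeff n = 0

/-- A matrix has all entries in `O_∞`. -/
def MatO (κ : Matrix (Fin 2) (Fin 2) (Kinf Fq)) : Prop := ∀ i j, memO Fq (κ i j)

/-- Membership in `GL₂(O_∞)`: entries in `O_∞` and determinant a unit of `O_∞`. -/
def InGLO (κ : Matrix (Fin 2) (Fin 2) (Kinf Fq)) : Prop :=
  MatO Fq κ ∧ κ.det.coeff 0 ≠ 0

/-- Membership in the Iwahori subgroup `I_∞ ⊆ GL₂(O_∞)`. -/
def InIw (κ : Matrix (Fin 2) (Fin 2) (Kinf Fq)) : Prop :=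
  InGLO Fq κ ∧ ∀ n : ℤ, n < 1 → (κ 1 0).coeff n = 0

/-- The matrix `diag(θ^r, 1)`. -/
def Dmat (r : ℕ) : Matrix (Fin 2) (Fin 2) (Kinf Fq) := !![thetaK Fq ^ r, 0; 0, 1]

/-- The matrix `(0, 1; π_∞, 0)`. -/
def Jmat : Matrix (Fin 2) (Fin 2) (Kinf Fq) := !![0, 1; piInf Fq, 0]

/-- The Atkin–Lehner/Fricke matrix `w_𝔫 = (0, -1; 𝔫, 0)`. -/
def wmat (𝔫 : Polynomial Fq) : Matrix (Fin 2) (Fin 2) (Kinf Fq) :=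
  !![0, -1; polyToK Fq 𝔫, 0]

/-- Membership in the Hecke congruence subgroup `Γ₀(𝔫) ⊆ GL₂(A)`. -/
def InGamma0 (𝔫 : Polynomial Fq) (γ : Matrix (Fin 2) (Fin 2) (Polynomial Fq)) : Prop :=
  IsUnit γ.det ∧ 𝔫 ∣ γ 1 0

/-- A `Γ₀(𝔫)`-invariant harmonic cochain, viewed as a function on `GL₂(K_∞)`
(encoded as a function on all matrices, with the conditions imposed on invertible ones). -/
def Harmonic (𝔫 : Polynomial Fq) (f : Matrix (Fin 2) (Fin 2) (Kinf Fq) → ℂ) : Prop :=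
  (∀ g : Matrix (Fin 2) (Fin 2) (Kinf Fq), g.det ≠ 0 →
    ∀ γ : Matrix (Fin 2) (Fin 2) (Polynomial Fq), InGamma0 Fq 𝔫 γ →
    ∀ z : Kinf Fq, z ≠ 0 → ∀ κ : Matrix (Fin 2) (Fin 2) (Kinf Fq), InIw Fq κ →
      f (γ.map (polyToK Fq) * g * (z • (1 : Matrix (Fin 2) (Fin 2) (Kinf Fq))) * κ) = f g)
  ∧ (∀ g : Matrix (Fin 2) (Fin 2) (Kinf Fq), g.det ≠ 0 → f (g * Jmat Fq) = - f g)
  ∧ (∀ g : Matrix (Fin 2) (Fin 2) (Kinf Fq), g.det ≠ 0 →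
      (∑ ε : Fq, f (g * !![1, 0; polyToK Fq (Polynomial.C ε), 1])) + f (g * !![0, 1; 1, 0]) = 0)

/-- A harmonic cochain is cuspidal if it is finitely supported modulo
`Γ₀(𝔫)` on the left and `K_∞^× I_∞` on the right. -/
def Cuspidal (𝔫 : Polynomial Fq) (f : Matrix (Fin 2) (Fin 2) (Kinf Fq) → ℂ) : Prop :=
  ∃ S : Finset (Matrix (Fin 2) (Fin 2) (Kinf Fq)),
    ∀ g : Matrix (Fin 2) (Fin 2) (Kinf Fq), g.det ≠ 0 → f g ≠ 0 →
      ∃ s ∈ S, ∃ γ : Matrix (Fin 2) (Fin 2) (Polynomial Fq), InGamma0 Fq 𝔫 γ ∧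
        ∃ z : Kinf Fq, z ≠ 0 ∧ ∃ κ : Matrix (Fin 2) (Fin 2) (Kinf Fq), InIw Fq κ ∧
          g = γ.map (polyToK Fq) * s * (z • (1 : Matrix (Fin 2) (Fin 2) (Kinf Fq))) * κ

/-- The additive character `ψ` of `K_∞`. -/
def psi (x : Kinf Fq) : ℂ :=
  letI := ZMod.algebra Fq (ringChar Fq)
  Complex.exp (2 * Real.pi * Complex.I *
    ((Algebra.trace (ZMod (ringChar Fq)) Fq (x.coeff 1)).val : ℂ) / (ringChar Fq : ℂ))

/-- The constant Fourier coefficient `c₀(f)`. -/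
def c0 (f : Matrix (Fin 2) (Fin 2) (Kinf Fq) → ℂ) : ℂ :=
  (Fintype.card Fq : ℂ)⁻¹ *
    ∑ c : Fq, f !![piInf Fq ^ 2, polyToK Fq (Polynomial.C c) * piInf Fq; 0, 1]

/-- The element `u = Σ_{i=1}^{d+1} c_i π_∞^i` of `K_∞` attached to a tuple of coefficients. -/
def uOf (d : ℕ) (c : Fin (d + 1) → Fq) : Kinf Fq :=
  ∑ i : Fin (d + 1), HahnSeries.single ((i : ℤ) + 1) (c i)

/-- The Fourier coefficient `c_𝔪(f)` for a monic polynomial `𝔪`. -/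
def cm (𝔪 : Polynomial Fq) (f : Matrix (Fin 2) (Fin 2) (Kinf Fq) → ℂ) : ℂ :=
  (Fintype.card Fq : ℂ)⁻¹ *
    ∑ c : Fin (𝔪.natDegree + 1) → Fq,
      f !![piInf Fq ^ (𝔪.natDegree + 2), uOf Fq 𝔪.natDegree c; 0, 1] *
        psi Fq (-(polyToK Fq 𝔪 * uOf Fq 𝔪.natDegree c))

/-- `δ_𝔫(c,d)`: the least `m` such that some `x, y` of degree at most `m`
satisfy `gcd(cx + dy, 𝔫) = 1`. -/
def deltaN (𝔫 c d : Polynomial Fq) : ℕ :=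
  sInf { m : ℕ | ∃ x y : Polynomial Fq, x.degree ≤ (m : WithBot ℕ) ∧
    y.degree ≤ (m : WithBot ℕ) ∧ IsCoprime (c * x + d * y) 𝔫 }

open Classical in
/-- `ε_𝔫(c,d) ∈ {0,1}`. -/
def epsN (𝔫 c d : Polynomial Fq) : ℕ :=
  if ∃ x₀ y₀ : Polynomial Fq, y₀.degree < x₀.degree ∧
      x₀.degree = (deltaN Fq 𝔫 c d : WithBot ℕ) ∧ IsCoprime (c * x₀ + d * y₀) 𝔫
  then 0 else 1

/-- The set `S(c,d;m)`. -/
def Sset (c d : Polynomial Fq) (m : ℕ) : Set (Polynomial Fq) :=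
  { z | ∃ x y : Polynomial Fq, x.degree ≤ (m : WithBot ℕ) ∧ y.degree ≤ (m : WithBot ℕ) ∧
      z = x * c + y * d }

/-- `t(c,d;m)`: the largest cardinality of a pairwise-coprime subset of `S(c,d;m)`. -/
def tcd (c d : Polynomial Fq) (m : ℕ) : ℕ :=
  sSup { n : ℕ | ∃ S' : Finset (Polynomial Fq), ↑S' ⊆ Sset Fq c d m ∧
    (∀ a ∈ S', ∀ b ∈ S', a ≠ b → IsCoprime a b) ∧ S'.card = n }

/-- `t(m,n) ∈ ℕ∞`. -/
def tmn (m n : ℕ) : ℕ∞ :=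
  sInf { k : ℕ∞ | ∃ c d : Polynomial Fq, IsCoprime c d ∧
    ((m : WithBot ℕ) + 1) < max c.degree d.degree ∧ max c.degree d.degree < (n : WithBot ℕ) ∧
    k = (tcd Fq c d m : ℕ∞) }

/-- `t(𝔫)`: the number of distinct monic prime factors of `𝔫`. -/
def tPrimes (𝔫 : Polynomial Fq) : ℕ :=
  Set.ncard { p : Polynomial Fq | p.Monic ∧ Irreducible p ∧ p ∣ 𝔫 }

/-- `τ(𝔫)`. -/
def tauN (𝔫 : Polynomial Fq) : ℕ :=
  sInf { m : ℕ | (tPrimes Fq 𝔫 : ℕ∞) < tmn Fq m 𝔫.natDegree }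

theorem polyToK_monomial {Fq : Type} [Field Fq] (n : ℕ) (a : Fq) :
    polyToK Fq (monomial n a) = HahnSeries.single (-(n : ℤ)) a := by
  have h : algebraMap Fq (Kinf Fq) a = HahnSeries.single 0 a := by
    simp [HahnSeries.algebraMap_apply']
  simp [polyToK, thetaK, Polynomial.aeval_monomial, HahnSeries.single_pow, h]

theorem polyToK_coeff_neg {Fq : Type} [Field Fq] (p : Polynomial Fq) (n : ℕ) :
    (polyToK Fq p).coeff (-(n : ℤ)) = p.coeff n := by
  induction p using Polynomial.induction_on' with
  | add p q hp hq => simp [hp, hq]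
  | monomial k a =>
    simp [polyToK_monomial, HahnSeries.coeff_single, Polynomial.coeff_monomial, eq_comm]

theorem polyToK_coeff_of_lt {Fq : Type} [Field Fq] (p : Polynomial Fq) (m : ℤ)
    (hm : m < -(p.natDegree : ℤ)) : (polyToK Fq p).coeff m = 0 := by
  obtain ⟨n, rfl⟩ : ∃ n : ℕ, m = -(n : ℤ) := ⟨(-m).toNat, by omega⟩
  rw [polyToK_coeff_neg]
  exact Polynomial.coeff_eq_zero_of_natDegree_lt (by omega)

theorem polyToK_ne_zero {Fq : Type} [Field Fq] {p : Polynomial Fq} (hp : p ≠ 0) :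
    polyToK Fq p ≠ 0 :=
  (map_ne_zero_iff _ (by
    refine (injective_iff_map_eq_zero _).2 fun p h => ?_
    ext n
    rw [← polyToK_coeff_neg, h]
    simp)).2 hp

theorem order_polyToK {Fq : Type} [Field Fq] {p : Polynomial Fq} (hp : p ≠ 0) :
    (polyToK Fq p).order = -(p.natDegree : ℤ) := by
  refine le_antisymm (HahnSeries.order_le_of_coeff_ne_zero ?_) ?_
  · rw [polyToK_coeff_neg]
    simpa using hp
  · by_contra! h
    exact HahnSeries.coeff_order_eq_zero.not.2 (polyToK_ne_zero hp) (polyToK_coeff_of_lt p _ h)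

theorem order_div {Fq : Type} [Field Fq] {x y : Kinf Fq} (hx : x ≠ 0) (hy : y ≠ 0) :
    (x / y).order = x.order - y.order := by
  have h := HahnSeries.order_mul (div_ne_zero hx hy) hy
  rw [div_mul_cancel₀ x hy] at h
  omega

theorem piInf_ne_zero {Fq : Type} [Field Fq] : piInf Fq ≠ 0 := by
  simp [piInf]

theorem order_piInf_pow {Fq : Type} [Field Fq] (n : ℕ) : (piInf Fq ^ n).order = n := by
  simp [piInf, HahnSeries.single_pow, HahnSeries.order_single]

theorem coeff_polyToK_div {Fq : Type} [Field Fq] {p q : Polynomial Fq} (hq : q ≠ 0) (m : ℤ)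
    (hm : m + p.natDegree < q.natDegree) : (polyToK Fq p / polyToK Fq q).coeff m = 0 := by
  rcases eq_or_ne p 0 with rfl | hp
  · simp
  · apply HahnSeries.coeff_eq_zero_of_lt_order
    rw [order_div (polyToK_ne_zero hp) (polyToK_ne_zero hq), order_polyToK hp, order_polyToK hq]
    omega

theorem order_unit_div {Fq : Type} [Field Fq] {D 𝔫 b : Polynomial Fq} (hD : IsUnit D)
    (h𝔫 : 𝔫 ≠ 0) (hb : b ≠ 0) :
    (polyToK Fq D / (polyToK Fq 𝔫 * polyToK Fq b ^ 2 *
      piInf Fq ^ (𝔫.natDegree + 2 * b.natDegree))).order = 0 := by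
  have h1 := polyToK_ne_zero h𝔫
  have h2 := polyToK_ne_zero hb
  have h3 : piInf Fq ≠ 0 := piInf_ne_zero
  rw [order_div (polyToK_ne_zero hD.ne_zero) (by positivity), order_polyToK hD.ne_zero,
    HahnSeries.order_mul (by positivity) (by positivity),
    HahnSeries.order_mul (by positivity) (by positivity), order_polyToK h𝔫, pow_two,
    HahnSeries.order_mul h2 h2, order_polyToK hb, order_piInf_pow,
    Polynomial.natDegree_eq_zero_of_isUnit hD]
  push_cast
  ring

theorem memO_of_order_eq_zero {Fq : Type} [Field Fq] {x : Kinf Fq} (h : x.order = 0) :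
    memO Fq x :=
  fun _ hn => HahnSeries.coeff_eq_zero_of_lt_order (h ▸ hn)

theorem coeff_zero_ne_zero {Fq : Type} [Field Fq] {x : Kinf Fq} (hx : x ≠ 0) (h : x.order = 0) :
    x.coeff 0 ≠ 0 := by
  rw [← h]
  exact HahnSeries.coeff_order_eq_zero.not.2 hx

theorem memO_one {Fq : Type} [Field Fq] : memO Fq (1 : Kinf Fq) :=
  memO_of_order_eq_zero HahnSeries.order_one

theorem memO_zero {Fq : Type} [Field Fq] : memO Fq (0 : Kinf Fq) :=
  fun _ _ => HahnSeries.coeff_zero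

/-- The standard form when the top row `(a', b')` satisfies `deg a' < deg b'`. -/
theorem standard_form_of_degree_lt {Fq : Type} [Field Fq] {𝔫 : Polynomial Fq} (h𝔫 : 𝔫 ≠ 0)
    {g : Matrix (Fin 2) (Fin 2) (Polynomial Fq)} (hg : IsUnit g.det)
    (hlt : (g 0 0).degree < (g 0 1).degree) :
    ∃ (u z : Kinf Fq) (κ : Matrix (Fin 2) (Fin 2) (Kinf Fq)), z ≠ 0 ∧ InIw Fq κ ∧
      g.map (polyToK Fq) =
        wmat Fq 𝔫 * !![piInf Fq ^ (𝔫.natDegree + 2 * (g 0 1).natDegree), u; 0, 1] *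
          (z • (1 : Matrix (Fin 2) (Fin 2) (Kinf Fq))) * κ := by
  have hb : g 0 1 ≠ 0 := by
    rintro h
    simp [h] at hlt
  have hn' := polyToK_ne_zero h𝔫
  have hb' := polyToK_ne_zero hb
  have hpi : piInf Fq ≠ 0 := piInf_ne_zero
  have hord := order_unit_div hg h𝔫 hb
  have hcoeff : ∀ n : ℤ, n < 1 → (polyToK Fq (g 0 0) / polyToK Fq (g 0 1)).coeff n = 0 := by
    intro n hn
    rcases eq_or_ne (g 0 0) 0 with h0 | h0
    · simp [h0]
    · have := Polynomial.natDegree_lt_natDegree h0 hlt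
      exact coeff_polyToK_div hb n (by omega)
  set k := polyToK Fq g.det / (polyToK Fq 𝔫 * polyToK Fq (g 0 1) ^ 2 *
      piInf Fq ^ (𝔫.natDegree + 2 * (g 0 1).natDegree)) with hk
  have hk0 : k ≠ 0 := div_ne_zero (polyToK_ne_zero hg.ne_zero) (by positivity)
  refine ⟨-polyToK Fq (g 1 1) / (polyToK Fq 𝔫 * polyToK Fq (g 0 1)), -polyToK Fq (g 0 1),
    !![k, 0; polyToK Fq (g 0 0) / polyToK Fq (g 0 1), 1], neg_ne_zero.2 hb', ⟨⟨?_, ?_⟩, hcoeff⟩, ?_⟩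
  · intro i j
    fin_cases i <;> fin_cases j
    · exact memO_of_order_eq_zero hord
    · exact memO_zero
    · exact fun n hn => hcoeff n (by omega)
    · exact memO_one
  · simpa [Matrix.det_fin_two] using coeff_zero_ne_zero hk0 hord
  · rw [Matrix.det_fin_two, map_sub, map_mul, map_mul] at hk
    ext1 i j
    fin_cases i <;> fin_cases j <;>
      simp [wmat, Matrix.mul_apply, Fin.sum_univ_two, hk] <;> field_simp
    ring

/-- The standard form when the top row `(a', b')` satisfies `deg b' ≤ deg a'`. -/
theorem standard_form_of_degree_le {Fq : Type} [Field Fq] {𝔫 : Polynomial Fq} (h𝔫 : 𝔫 ≠ 0)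
    {g : Matrix (Fin 2) (Fin 2) (Polynomial Fq)} (hg : IsUnit g.det) (ha : g 0 0 ≠ 0)
    (hle : (g 0 1).degree ≤ (g 0 0).degree) :
    ∃ (u z : Kinf Fq) (κ : Matrix (Fin 2) (Fin 2) (Kinf Fq)), z ≠ 0 ∧ InIw Fq κ ∧
      g.map (polyToK Fq) =
        wmat Fq 𝔫 * !![piInf Fq ^ (𝔫.natDegree + 2 * (g 0 0).natDegree + 1), u; 0, 1] *
          Jmat Fq * (z • (1 : Matrix (Fin 2) (Fin 2) (Kinf Fq))) * κ := by
  have hn' := polyToK_ne_zero h𝔫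
  have ha' := polyToK_ne_zero ha
  have hpi : piInf Fq ≠ 0 := piInf_ne_zero
  have hord := order_unit_div hg h𝔫 ha
  have hdeg := Polynomial.natDegree_le_natDegree hle
  set k := polyToK Fq g.det / (polyToK Fq 𝔫 * polyToK Fq (g 0 0) ^ 2 *
      piInf Fq ^ (𝔫.natDegree + 2 * (g 0 0).natDegree)) with hk
  have hk0 : k ≠ 0 := div_ne_zero (polyToK_ne_zero hg.ne_zero) (by positivity)
  refine ⟨-polyToK Fq (g 1 0) / (polyToK Fq 𝔫 * polyToK Fq (g 0 0)),
    -polyToK Fq (g 0 0) / piInf Fq,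
    !![1, polyToK Fq (g 0 1) / polyToK Fq (g 0 0); 0, -k],
    div_ne_zero (neg_ne_zero.2 ha') hpi, ⟨⟨?_, ?_⟩, fun _ _ => HahnSeries.coeff_zero⟩, ?_⟩
  · intro i j
    fin_cases i <;> fin_cases j
    · exact memO_one
    · exact fun n hn => coeff_polyToK_div ha n (by omega)
    · exact memO_zero
    · exact memO_of_order_eq_zero (by simpa using hord)
  · simpa [Matrix.det_fin_two] using coeff_zero_ne_zero hk0 hord
  · rw [Matrix.det_fin_two, map_sub, map_mul, map_mul] at hk
    ext1 i j
    fin_cases i <;> fin_cases j <;>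
      simp [wmat, Jmat, Matrix.mul_apply, Fin.sum_univ_two, hk] <;> field_simp
    ring

/-- A coprime pair `(x, y)` with `cx + dy` coprime to `𝔫` gives a `Γ₀(𝔫)`-translate of `γ`
with top row `(y, -x)`. -/
theorem exists_gamma0_top_row {Fq : Type} [Field Fq] {𝔫 : Polynomial Fq}
    {γ : Matrix (Fin 2) (Fin 2) (Polynomial Fq)} (hγ : IsUnit γ.det) {x y : Polynomial Fq}
    (hxy : IsCoprime x y) (h : IsCoprime (γ 1 0 * x + γ 1 1 * y) 𝔫) :
    ∃ γ₀ : Matrix (Fin 2) (Fin 2) (Polynomial Fq), InGamma0 Fq 𝔫 γ₀ ∧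
      IsUnit (γ₀ * γ).det ∧ (γ₀ * γ) 0 0 = y ∧ (γ₀ * γ) 0 1 = -x := by
  obtain ⟨D, hD⟩ := hγ.exists_left_inv
  have hDu : IsUnit D := IsUnit.of_mul_eq_one _ hD
  rw [Matrix.det_fin_two] at hD
  set α := D * (γ 1 0 * x + γ 1 1 * y) with hα
  set β := -(D * (γ 0 0 * x + γ 0 1 * y)) with hβ
  have e1 : α * γ 0 0 + β * γ 1 0 = y := by
    rw [hα, hβ]; linear_combination y * hD
  have e2 : α * γ 0 1 + β * γ 1 1 = -x := by
    rw [hα, hβ]; linear_combination -x * hD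
  have hα𝔫 : IsCoprime α 𝔫 := (isCoprime_mul_unit_left_left hDu _ _).2 h
  have hαβ : IsCoprime α β := by
    obtain ⟨p, q, hpq⟩ := hxy
    exact ⟨q * γ 0 0 - p * γ 0 1, q * γ 1 0 - p * γ 1 1, by
      linear_combination hpq + q * e1 - p * e2⟩
  obtain ⟨s, t, hst⟩ := hα𝔫.mul_right hαβ
  have hdet : (!![α, β; -(𝔫 * t), s]).det = 1 := by
    rw [Matrix.det_fin_two_of]
    linear_combination hst
  refine ⟨!![α, β; -(𝔫 * t), s], ⟨by simp [hdet], by simp⟩, ?_, ?_, ?_⟩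
  · rwa [Matrix.det_mul, hdet, one_mul]
  · simpa [Matrix.mul_apply, Fin.sum_univ_two] using e1
  · simpa [Matrix.mul_apply, Fin.sum_univ_two] using e2

theorem deltaN_le {Fq : Type} [Field Fq] {𝔫 c d x y : Polynomial Fq} {m : ℕ}
    (hx : x.natDegree ≤ m) (hy : y.natDegree ≤ m) (h : IsCoprime (c * x + d * y) 𝔫) :
    deltaN Fq 𝔫 c d ≤ m :=
  Nat.sInf_le ⟨x, y, Polynomial.natDegree_le_iff_degree_le.1 hx,
    Polynomial.natDegree_le_iff_degree_le.1 hy, h⟩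

theorem exists_deltaN {Fq : Type} [Field Fq] {𝔫 c d : Polynomial Fq} (hcd : IsCoprime c d) :
    ∃ x y : Polynomial Fq, x.natDegree ≤ deltaN Fq 𝔫 c d ∧ y.natDegree ≤ deltaN Fq 𝔫 c d ∧
      IsCoprime (c * x + d * y) 𝔫 := by
  obtain ⟨p, q, hpq⟩ := hcd
  have hne : { m : ℕ | ∃ x y : Polynomial Fq, x.degree ≤ (m : WithBot ℕ) ∧
      y.degree ≤ (m : WithBot ℕ) ∧ IsCoprime (c * x + d * y) 𝔫 }.Nonempty :=
    ⟨max p.natDegree q.natDegree, p, q,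
      Polynomial.natDegree_le_iff_degree_le.1 (le_max_left _ _),
      Polynomial.natDegree_le_iff_degree_le.1 (le_max_right _ _), by
        rw [mul_comm c, mul_comm d, hpq]; exact isCoprime_one_left⟩
  obtain ⟨x, y, hx, hy, h⟩ := Nat.sInf_mem hne
  exact ⟨x, y, Polynomial.natDegree_le_iff_degree_le.2 hx,
    Polynomial.natDegree_le_iff_degree_le.2 hy, h⟩

/-- A nonzero minimizing pair is coprime. -/
theorem isCoprime_of_natDegree_le_deltaN {Fq : Type} [Field Fq] {𝔫 c d x y : Polynomial Fq}
    (h0 : x ≠ 0 ∨ y ≠ 0)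
    (hx : x.natDegree ≤ deltaN Fq 𝔫 c d) (hy : y.natDegree ≤ deltaN Fq 𝔫 c d)
    (h : IsCoprime (c * x + d * y) 𝔫) : IsCoprime x y := by
  classical
  obtain ⟨x', hx'⟩ := EuclideanDomain.gcd_dvd_left x y
  obtain ⟨y', hy'⟩ := EuclideanDomain.gcd_dvd_right x y
  rw [← EuclideanDomain.gcd_isUnit_iff]
  have hg : EuclideanDomain.gcd x y ≠ 0 := by
    rw [Ne, EuclideanDomain.gcd_eq_zero_iff]
    tauto
  set g := EuclideanDomain.gcd x y
  have hle : ∀ {w w' : Polynomial Fq}, w = g * w' → w.natDegree ≤ deltaN Fq 𝔫 c d →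
      w'.natDegree ≤ deltaN Fq 𝔫 c d - g.natDegree := by
    intro w w' hw hwd
    rcases eq_or_ne w' 0 with rfl | hw'
    · simp
    · rw [hw, Polynomial.natDegree_mul hg hw'] at hwd
      omega
  have hgle : g.natDegree ≤ deltaN Fq 𝔫 c d := by
    rcases h0 with h0 | h0
    · exact (Polynomial.natDegree_le_of_dvd (EuclideanDomain.gcd_dvd_left x y) h0).trans hx
    · exact (Polynomial.natDegree_le_of_dvd (EuclideanDomain.gcd_dvd_right x y) h0).trans hy
  have hcop : IsCoprime (c * x' + d * y') 𝔫 := by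
    refine IsCoprime.of_mul_left_right (x := g) ?_
    convert h using 1
    rw [hx', hy']
    ring
  have := deltaN_le (hle hx' hx) (hle hy' hy) hcop
  exact Polynomial.isUnit_iff_degree_eq_zero.2
    ((Polynomial.degree_eq_iff_natDegree_eq hg).2 (show g.natDegree = 0 by omega))

/-- **Standard form of the edge `γ·e₀` in terms of `δ_𝔫` and `ε_𝔫`.** -/
theorem standard_form_edge_delta_eps
    (Fq : Type) [Field Fq] [Fintype Fq]
    (𝔫 : Polynomial Fq) (h𝔫 : 𝔫.Monic)
    (γ : Matrix (Fin 2) (Fin 2) (Polynomial Fq)) (hγ : IsUnit γ.det) :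
    ∃ γ₀ : Matrix (Fin 2) (Fin 2) (Polynomial Fq), InGamma0 Fq 𝔫 γ₀ ∧
      ∃ (u z : Kinf Fq) (κ : Matrix (Fin 2) (Fin 2) (Kinf Fq)), z ≠ 0 ∧ InIw Fq κ ∧
        (γ₀ * γ).map (polyToK Fq) =
          wmat Fq 𝔫 *
            !![piInf Fq ^ (𝔫.natDegree + 2 * deltaN Fq 𝔫 (γ 1 0) (γ 1 1)
                  + epsN Fq 𝔫 (γ 1 0) (γ 1 1)), u; 0, 1] *
            Jmat Fq ^ (epsN Fq 𝔫 (γ 1 0) (γ 1 1)) *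
            (z • (1 : Matrix (Fin 2) (Fin 2) (Kinf Fq))) * κ := by
  have hcd : IsCoprime (γ 1 0) (γ 1 1) := by
    obtain ⟨D, hD⟩ := hγ.exists_left_inv
    rw [Matrix.det_fin_two] at hD
    exact ⟨-(D * γ 0 1), D * γ 0 0, by linear_combination hD⟩
  by_cases hε : ∃ x₀ y₀ : Polynomial Fq, y₀.degree < x₀.degree ∧
      x₀.degree = (deltaN Fq 𝔫 (γ 1 0) (γ 1 1) : WithBot ℕ) ∧
      IsCoprime (γ 1 0 * x₀ + γ 1 1 * y₀) 𝔫
  · have heps : epsN Fq 𝔫 (γ 1 0) (γ 1 1) = 0 := if_pos hε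
    obtain ⟨x, y, hlt, hx, h⟩ := hε
    have hx0 : x ≠ 0 := by
      rintro rfl
      simp at hlt
    have hxd := Polynomial.natDegree_eq_of_degree_eq_some hx
    have hyd := Polynomial.natDegree_le_natDegree hlt.le
    have hxy := isCoprime_of_natDegree_le_deltaN (Or.inl hx0) hxd.le (hyd.trans hxd.le) h
    obtain ⟨γ₀, hγ₀, hdet, h00, h01⟩ := exists_gamma0_top_row hγ hxy h
    obtain ⟨u, z, κ, hz, hκ, heq⟩ := standard_form_of_degree_lt h𝔫.ne_zero hdet
      (by rwa [h00, h01, Polynomial.degree_neg])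
    refine ⟨γ₀, hγ₀, u, z, κ, hz, hκ, ?_⟩
    rw [h01, Polynomial.natDegree_neg, hxd] at heq
    rw [heq, heps, pow_zero, mul_one, add_zero]
  · have heps : epsN Fq 𝔫 (γ 1 0) (γ 1 1) = 1 := if_neg hε
    obtain ⟨x, y, hx, hy, h⟩ := exists_deltaN (𝔫 := 𝔫) hcd
    have hxy0 : x ≠ 0 ∨ y ≠ 0 := by
      by_contra! h0
      have hu : IsUnit 𝔫 := by simpa [h0.1, h0.2, isCoprime_zero_left] using h
      have hδ : deltaN Fq 𝔫 (γ 1 0) (γ 1 1) = 0 :=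
        Nat.le_zero.1 (deltaN_le (x := 0) (y := 0) (by simp) (by simp)
          (by simpa [isCoprime_zero_left] using hu))
      obtain ⟨v, hv⟩ := hu.exists_left_inv
      exact hε ⟨1, 0, by simp, by simp [hδ], IsCoprime.symm ⟨v, 0, by simp [hv]⟩⟩
    have hmax := deltaN_le (le_max_left x.natDegree y.natDegree) (le_max_right _ _) h
    have hle : x.degree ≤ y.degree := by
      by_contra! hlt
      have hx0 : x ≠ 0 := by
        rintro rfl
        simp at hlt
      have := Polynomial.natDegree_le_natDegree hlt.le
      exact hε ⟨x, y, hlt, (Polynomial.degree_eq_iff_natDegree_eq hx0).2 (by omega), h⟩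
    have hy0 : y ≠ 0 := by
      rintro rfl
      simp at hle
      simp [hle] at hxy0
    have hyd : y.natDegree = deltaN Fq 𝔫 (γ 1 0) (γ 1 1) := by
      have := Polynomial.natDegree_le_natDegree hle
      omega
    obtain ⟨γ₀, hγ₀, hdet, h00, h01⟩ :=
      exists_gamma0_top_row hγ (isCoprime_of_natDegree_le_deltaN hxy0 hx hy h) h
    obtain ⟨u, z, κ, hz, hκ, heq⟩ := standard_form_of_degree_le h𝔫.ne_zero hdet
      (by rwa [h00]) (by rwa [h00, h01, Polynomial.degree_neg])
    refine ⟨γ₀, hγ₀, u, z, κ, hz, hκ, ?_⟩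
    rw [h00, hyd] at heq
    rw [heq, heps, pow_one]

end SturmFF
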